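/- Let n ≥ 2 and let f : ℝⁿ → ℝ be a C² function whose mean curvature does not change sign, i.e. either H(x) ≥ 0 for all x ∈ ℝⁿ or H(x) ≤ 0 for all x ∈ ℝⁿ. Then inf_{x∈ℝⁿ} |A|(x) = 0, where |A|(x) = √(tr(W(x)²)); equivalently, for every ε > 0 there exists x ∈ ℝⁿ with |A|(x) < ε. -/

import Mathlib

open Metric Finset

/-- Coordinates of the gradient of `f` at `x`. -/
noncomputable def grad (n : ℕ) (f : EuclideanSpace ℝ (Fin n) → ℝ)
    (x : EuclideanSpace ℝ (Fin n)) : Fin n → ℝ :=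
  fun i => fderiv ℝ f x (EuclideanSpace.single i 1)

/-- The Hessian matrix `D²f(x)`. -/
noncomputable def hess (n : ℕ) (f : EuclideanSpace ℝ (Fin n) → ℝ)
    (x : EuclideanSpace ℝ (Fin n)) : Matrix (Fin n) (Fin n) ℝ :=
  Matrix.of fun i j =>
    fderiv ℝ (fun y => fderiv ℝ f y (EuclideanSpace.single j 1)) x (EuclideanSpace.single i 1)

/-- `|∇f(x)|²`. -/
noncomputable def gradSq (n : ℕ) (f : EuclideanSpace ℝ (Fin n) → ℝ)
    (x : EuclideanSpace ℝ (Fin n)) : ℝ :=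
  ∑ i, grad n f x i ^ 2

/-- The shape operator of the graph of `f`, with respect to the upward unit normal:
`W(x) = (1+|∇f|²)^{-1/2} (Iₙ - ∇f ∇fᵀ/(1+|∇f|²)) D²f(x)`. -/
noncomputable def shapeOp (n : ℕ) (f : EuclideanSpace ℝ (Fin n) → ℝ)
    (x : EuclideanSpace ℝ (Fin n)) : Matrix (Fin n) (Fin n) ℝ :=
  (Real.sqrt (1 + gradSq n f x))⁻¹ •
    (((1 : Matrix (Fin n) (Fin n) ℝ) -
      Matrix.of fun i j => grad n f x i * grad n f x j / (1 + gradSq n f x)) * hess n f x)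

/-- The mean curvature `H(x) = tr W(x) / n`. -/
noncomputable def meanCurv (n : ℕ) (f : EuclideanSpace ℝ (Fin n) → ℝ)
    (x : EuclideanSpace ℝ (Fin n)) : ℝ :=
  (shapeOp n f x).trace / n

/-- The scalar curvature `R(x) = ((tr W)² - tr(W²)) / (n(n-1))`. -/
noncomputable def scalarCurv (n : ℕ) (f : EuclideanSpace ℝ (Fin n) → ℝ)
    (x : EuclideanSpace ℝ (Fin n)) : ℝ :=
  ((shapeOp n f x).trace ^ 2 - (shapeOp n f x * shapeOp n f x).trace) /
    ((n : ℝ) * ((n : ℝ) - 1))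

/-- The length `|A|(x) = √(tr(W(x)²))` of the second fundamental form. -/
noncomputable def normA (n : ℕ) (f : EuclideanSpace ℝ (Fin n) → ℝ)
    (x : EuclideanSpace ℝ (Fin n)) : ℝ :=
  Real.sqrt ((shapeOp n f x * shapeOp n f x).trace)

/-- Necessary conditions for a local minimum, up to second order. -/
theorem IsLocalMin.deriv_eq_zero_and_deriv_deriv_nonneg {h h' : ℝ → ℝ} {h'' a : ℝ}
    (hmin : IsLocalMin h a) (hd : ∀ᶠ t in nhds a, HasDerivAt h (h' t) t)
    (hd' : HasDerivAt h' h'' a) : h' a = 0 ∧ 0 ≤ h'' := by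
  have h0 : h' a = 0 := hmin.hasDerivAt_eq_zero hd.self_of_nhds
  refine ⟨h0, ?_⟩
  by_contra! hneg
  have heq : deriv h =ᶠ[nhds a] h' := hd.mono fun t ht => ht.deriv
  have hdd : deriv (deriv h) a = h'' := by rw [heq.deriv_eq, hd'.deriv]
  have hmax : IsLocalMax h a := isLocalMax_of_deriv_deriv_neg (by rw [hdd]; exact hneg)
    (by rw [hd.self_of_nhds.deriv, h0]) hd.self_of_nhds.continuousAt
  have hconst : h =ᶠ[nhds a] fun _ => h a := by
    filter_upwards [hmin, hmax] with t h1 h2 using le_antisymm h2 h1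
  have hz : deriv h =ᶠ[nhds a] fun _ => 0 := by
    filter_upwards [hconst.eventuallyEq_nhds] with t ht
    rw [ht.deriv_eq, deriv_const]
  rw [hz.deriv_eq, deriv_const] at hdd
  exact hneg.ne hdd.symm

open scoped MatrixOrder in
/-- For a positive semidefinite `B`, `tr (B²) ≤ (tr B)²`. -/
theorem Matrix.PosSemidef.trace_mul_self_le {n : ℕ} {B : Matrix (Fin n) (Fin n) ℝ}
    (hB : B.PosSemidef) : (B * B).trace ≤ B.trace ^ 2 := by
  obtain ⟨C, rfl⟩ := CStarAlgebra.nonneg_iff_eq_star_mul_self.mp hB.nonneg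
  simp only [Matrix.trace, Matrix.diag, Matrix.mul_apply, Matrix.star_apply, star_trivial]
  rw [sq, Finset.sum_mul_sum]
  refine Finset.sum_le_sum fun i _ => Finset.sum_le_sum fun j _ => ?_
  have h := Finset.sum_mul_sq_le_sq_mul_sq Finset.univ (fun k => C k i) (fun k => C k j)
  calc (∑ k, C k i * C k j) * ∑ k, C k j * C k i = (∑ k, C k i * C k j) ^ 2 := by
        rw [sq]; simp only [mul_comm]
    _ ≤ _ := by simpa only [sq] using h

open scoped MatrixOrder in
/-- For positive semidefinite `P` and `K`, the matrix `PK` has nonnegative trace, and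
`tr ((PK)²) ≤ (tr (PK))²`. -/
theorem Matrix.PosSemidef.trace_mul_nonneg_and_trace_mul_sq_le {n : ℕ}
    {P K : Matrix (Fin n) (Fin n) ℝ} (hP : P.PosSemidef) (hK : K.PosSemidef) :
    0 ≤ (P * K).trace ∧ (P * K * (P * K)).trace ≤ (P * K).trace ^ 2 := by
  obtain ⟨C, rfl⟩ := CStarAlgebra.nonneg_iff_eq_star_mul_self.mp hP.nonneg
  have hB : (C * K * star C).PosSemidef := hK.mul_mul_conjTranspose_same C
  have h1 : (star C * C * K).trace = (C * K * star C).trace := by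
    rw [Matrix.mul_assoc, Matrix.trace_mul_comm]
  have h2 : (star C * C * K * (star C * C * K)).trace
      = (C * K * star C * (C * K * star C)).trace := by
    rw [Matrix.mul_assoc (star C) C K, Matrix.mul_assoc (star C), Matrix.trace_mul_comm]
    simp only [Matrix.mul_assoc]
  rw [h1, h2]
  exact ⟨hB.trace_nonneg, hB.trace_mul_self_le⟩

theorem hess_apply {n : ℕ} {f : EuclideanSpace ℝ (Fin n) → ℝ}
    (hf : ContDiff ℝ 2 f) (x : EuclideanSpace ℝ (Fin n)) (i j : Fin n) :
    hess n f x i j = fderiv ℝ (fderiv ℝ f) x (EuclideanSpace.single i 1)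
      (EuclideanSpace.single j 1) := by
  have hF : DifferentiableAt ℝ (fderiv ℝ f) x :=
    (hf.fderiv_right (m := 1) (by norm_num)).differentiable (by norm_num) x
  rw [hess, Matrix.of_apply, fderiv_clm_apply hF (differentiableAt_const _)]
  simp

theorem hess_isHermitian {n : ℕ} {f : EuclideanSpace ℝ (Fin n) → ℝ}
    (hf : ContDiff ℝ 2 f) (x : EuclideanSpace ℝ (Fin n)) : (hess n f x).IsHermitian := by
  refine Matrix.IsHermitian.ext fun i j => ?_
  rw [star_trivial, hess_apply hf, hess_apply hf]
  exact hf.contDiffAt.isSymmSndFDerivAt (by simp) _ _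

theorem toLp_eq_sum_smul_single {n : ℕ} (v : Fin n → ℝ) :
    WithLp.toLp 2 v = ∑ i, v i • EuclideanSpace.single i (1 : ℝ) := by
  ext j
  simp [Finset.sum_apply, Pi.single_apply]

theorem fderiv_toLp_eq_dotProduct_grad {n : ℕ} (f : EuclideanSpace ℝ (Fin n) → ℝ)
    (x : EuclideanSpace ℝ (Fin n)) (v : Fin n → ℝ) :
    fderiv ℝ f x (WithLp.toLp 2 v) = v ⬝ᵥ grad n f x := by
  simp [toLp_eq_sum_smul_single, dotProduct, grad]

theorem fderiv_fderiv_toLp_eq_dotProduct_hess {n : ℕ} {f : EuclideanSpace ℝ (Fin n) → ℝ}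
    (hf : ContDiff ℝ 2 f) (x : EuclideanSpace ℝ (Fin n)) (v : Fin n → ℝ) :
    fderiv ℝ (fderiv ℝ f) x (WithLp.toLp 2 v) (WithLp.toLp 2 v) = v ⬝ᵥ (hess n f x).mulVec v := by
  simp only [toLp_eq_sum_smul_single, map_sum, map_smul, _root_.sum_apply,
    _root_.smul_apply, dotProduct, Matrix.mulVec, hess_apply hf, smul_eq_mul,
    Finset.mul_sum]
  rw [Finset.sum_comm]
  refine Finset.sum_congr rfl fun i _ => Finset.sum_congr rfl fun j _ => by ring

/-- The function `x ↦ -√(r² - ‖x‖²) - f x` attains its minimum over the closed ball of radius `r`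
at an interior point: a large sphere lowered onto the graph of `f` touches it there. -/
theorem exists_isLocalMin_neg_sqrt_sub {E : Type*} [NormedAddCommGroup E] [NormedSpace ℝ E]
    [ProperSpace E] {f : E → ℝ} (hf : Differentiable ℝ f) {r : ℝ} (hr : 0 < r) :
    ∃ x, ‖x‖ < r ∧ IsLocalMin (fun y => -Real.sqrt (r ^ 2 - ‖y‖ ^ 2) - f y) x := by
  have hc : Continuous fun y : E => -Real.sqrt (r ^ 2 - ‖y‖ ^ 2) - f y := by
    have := hf.continuous
    fun_prop
  obtain ⟨x, hx, hmin⟩ := (isCompact_closedBall (0 : E) r).exists_isMinOn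
    ⟨0, by simp [hr.le]⟩ hc.continuousOn
  rw [mem_closedBall_zero_iff] at hx
  have hlt : ‖x‖ < r := by
    refine lt_of_le_of_ne hx fun hxr => ?_
    have hline : HasDerivAt (fun t : ℝ => f (t • x)) (fderiv ℝ f x x) 1 := by
      have h1 : HasDerivAt (fun t : ℝ => t • x) x 1 := by
        simpa using (hasDerivAt_id (1 : ℝ)).smul_const x
      have h2 : HasFDerivAt f (fderiv ℝ f x) ((1 : ℝ) • x) := by
        rw [one_smul]; exact (hf x).hasFDerivAt
      exact h2.comp_hasDerivAt 1 h1
    obtain ⟨L, hL, hbound⟩ := hline.isBigO_sub.exists_pos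
    have hsmall : ∀ᶠ t : ℝ in nhds 1, L * Real.sqrt (1 - t) < r := by
      have hcont : Continuous fun t : ℝ => L * Real.sqrt (1 - t) := by fun_prop
      exact hcont.continuousAt.eventually_lt continuousAt_const (by simpa using hr)
    have hleft : ∀ᶠ t : ℝ in nhdsWithin 1 (Set.Iio 1), 0 < t ∧ t < 1 :=
      Ioo_mem_nhdsLT one_pos
    obtain ⟨t, ⟨ht0, ht1⟩, hts, htb⟩ := (hleft.and
      (nhdsWithin_le_nhds (hsmall.and hbound.bound))).exists
    have hnorm : ‖t • x‖ = t * r := by rw [norm_smul, Real.norm_of_nonneg ht0.le, hxr]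
    have h := hmin (mem_closedBall_zero_iff.mpr (by rw [hnorm]; nlinarith : ‖t • x‖ ≤ r))
    simp only [Set.mem_ofPred_eq, hnorm, hxr, sub_self, Real.sqrt_zero, one_smul] at h htb
    have habs : ‖t - 1‖ = 1 - t := by rw [Real.norm_eq_abs, abs_of_neg (by linarith)]; ring
    rw [habs, Real.norm_eq_abs] at htb
    have hs := Real.sq_sqrt (by linarith : 0 ≤ 1 - t)
    have hspos : 0 < Real.sqrt (1 - t) := Real.sqrt_pos.mpr (by linarith)
    have hge : r * Real.sqrt (1 - t) ≤ Real.sqrt (r ^ 2 - (t * r) ^ 2) := by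
      refine Real.le_sqrt_of_sq_le ?_
      rw [mul_pow, hs]
      nlinarith [mul_pos (mul_pos ht0 (sub_pos.mpr ht1)) (sq_pos_of_pos hr)]
    have := (abs_le.mp htb).1
    nlinarith
  refine ⟨x, hlt, ?_⟩
  filter_upwards [isOpen_ball.mem_nhds (mem_ball_zero_iff.mpr hlt)] with y hy
  exact hmin (ball_subset_closedBall hy)

/-- At an interior point where `-√(r² - ‖x‖²) - f x` has a local minimum, the first two
derivatives of `f` compare with those of the sphere of radius `r`. -/
theorem fderiv_eq_and_fderiv_fderiv_le_of_isLocalMin {E : Type*} [NormedAddCommGroup E]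
    [InnerProductSpace ℝ E] {f : E → ℝ} (hf : ContDiff ℝ 2 f) {r : ℝ} {x : E} (hx : ‖x‖ < r)
    (hmin : IsLocalMin (fun y => -Real.sqrt (r ^ 2 - ‖y‖ ^ 2) - f y) x) (v : E) :
    fderiv ℝ f x v = inner ℝ x v / Real.sqrt (r ^ 2 - ‖x‖ ^ 2) ∧
    fderiv ℝ (fderiv ℝ f) x v v ≤
      (‖v‖ ^ 2 + (fderiv ℝ f x v) ^ 2) / Real.sqrt (r ^ 2 - ‖x‖ ^ 2) := by
  have hpos : 0 < r ^ 2 - ‖x‖ ^ 2 := by nlinarith [norm_nonneg x]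
  set s := Real.sqrt (r ^ 2 - ‖x‖ ^ 2) with hs
  have hs0 : 0 < s := Real.sqrt_pos.mpr hpos
  have hs2 : s ^ 2 = r ^ 2 - ‖x‖ ^ 2 := Real.sq_sqrt hpos.le
  set b := inner ℝ x v with hb
  have hnorm (t : ℝ) : r ^ 2 - ‖x + t • v‖ ^ 2 = s ^ 2 - 2 * b * t - ‖v‖ ^ 2 * t ^ 2 := by
    rw [norm_add_sq_real, inner_smul_right, norm_smul, mul_pow, Real.norm_eq_abs, sq_abs, hs2]
    ring
  have hline (t : ℝ) : HasDerivAt (fun t : ℝ => x + t • v) v t := by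
    simpa using ((hasDerivAt_id t).smul_const v).const_add x
  have hu (t : ℝ) : HasDerivAt (fun t : ℝ => f (x + t • v)) (fderiv ℝ f (x + t • v) v) t :=
    ((hf.differentiable (by norm_num)) _).hasFDerivAt.comp_hasDerivAt t (hline t)
  have hu' : HasDerivAt (fun t : ℝ => fderiv ℝ f (x + t • v) v)
      (fderiv ℝ (fderiv ℝ f) x v v) 0 := by
    have hF : DifferentiableAt ℝ (fderiv ℝ f) (x + (0 : ℝ) • v) :=
      (hf.fderiv_right (m := 1) (by norm_num)).differentiable (by norm_num) _
    rw [zero_smul, add_zero] at hF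
    have h1 : HasDerivAt (fun t : ℝ => fderiv ℝ f (x + t • v)) (fderiv ℝ (fderiv ℝ f) x v) 0 :=
      HasFDerivAt.comp_hasDerivAt_of_eq 0 hF.hasFDerivAt (hline 0) (by simp)
    exact (ContinuousLinearMap.apply ℝ ℝ v).hasFDerivAt.comp_hasDerivAt 0 h1
  have ha (t : ℝ) : HasDerivAt (fun t : ℝ => s ^ 2 - 2 * b * t - ‖v‖ ^ 2 * t ^ 2)
      (-2 * (b + ‖v‖ ^ 2 * t)) t := by
    have h1 : HasDerivAt (fun t : ℝ => 2 * b * t) (2 * b) t := hasDerivAt_const_mul _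
    have h2 : HasDerivAt (fun t : ℝ => ‖v‖ ^ 2 * t ^ 2) (‖v‖ ^ 2 * (2 * t)) t := by
      simpa using (hasDerivAt_pow 2 t).const_mul (‖v‖ ^ 2)
    exact ((h1.const_sub (s ^ 2)).fun_sub h2).congr_deriv (by ring)
  have hsqrt (t : ℝ) (ht : 0 < s ^ 2 - 2 * b * t - ‖v‖ ^ 2 * t ^ 2) :
      HasDerivAt (fun t : ℝ => Real.sqrt (s ^ 2 - 2 * b * t - ‖v‖ ^ 2 * t ^ 2))
        (-((b + ‖v‖ ^ 2 * t) / Real.sqrt (s ^ 2 - 2 * b * t - ‖v‖ ^ 2 * t ^ 2))) t := by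
    convert (ha t).sqrt ht.ne' using 1
    have := Real.sqrt_pos.mpr ht
    field_simp
  have hev : ∀ᶠ t : ℝ in nhds 0, 0 < s ^ 2 - 2 * b * t - ‖v‖ ^ 2 * t ^ 2 :=
    continuousAt_const.eventually_lt (ha 0).continuousAt (by simpa using pow_pos hs0 2)
  have hquot : HasDerivAt
      (fun t : ℝ => (b + ‖v‖ ^ 2 * t) / Real.sqrt (s ^ 2 - 2 * b * t - ‖v‖ ^ 2 * t ^ 2))
      ((‖v‖ ^ 2 + (b / s) ^ 2) / s) 0 := by
    have hnum : HasDerivAt (fun t : ℝ => b + ‖v‖ ^ 2 * t) (‖v‖ ^ 2) 0 := by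
      simpa using ((hasDerivAt_id (0 : ℝ)).const_mul (‖v‖ ^ 2)).const_add b
    refine (hnum.fun_div (hsqrt 0 hev.self_of_nhds)
      (Real.sqrt_pos.mpr hev.self_of_nhds).ne').congr_deriv ?_
    simp only [mul_zero, sub_zero, add_zero, ne_eq, OfNat.ofNat_ne_zero, not_false_eq_true,
      zero_pow, Real.sqrt_sq hs0.le]
    field_simp
    ring
  have hlmin : IsLocalMin
      (fun t : ℝ => -Real.sqrt (s ^ 2 - 2 * b * t - ‖v‖ ^ 2 * t ^ 2) - f (x + t • v)) 0 := by
    have htend : Filter.Tendsto (fun t : ℝ => x + t • v) (nhds 0) (nhds x) := by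
      simpa using (hline 0).continuousAt.tendsto
    filter_upwards [htend.eventually hmin] with t ht
    have h0 := hnorm 0
    rw [zero_smul, add_zero] at h0
    rw [hnorm, h0] at ht
    simpa using ht
  obtain ⟨h1, h2⟩ := hlmin.deriv_eq_zero_and_deriv_deriv_nonneg
    (hev.mono fun t ht => (hsqrt t ht).neg.sub (hu t)) ((by simpa using hquot : HasDerivAt
      (fun t : ℝ => - -((b + ‖v‖ ^ 2 * t) / Real.sqrt (s ^ 2 - 2 * b * t - ‖v‖ ^ 2 * t ^ 2)))
      ((‖v‖ ^ 2 + (b / s) ^ 2) / s) 0).sub hu')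
  have h3 : fderiv ℝ f x v = b / s := by
    simp [Real.sqrt_sq hs0.le] at h1
    linarith
  exact ⟨h3, by rw [h3]; linarith⟩

theorem Matrix.posSemidef_one_sub_of_div {n : ℕ} (p : Fin n → ℝ) :
    ((1 : Matrix (Fin n) (Fin n) ℝ) -
      Matrix.of fun i j => p i * p j / (1 + ∑ k, p k ^ 2)).PosSemidef := by
  have hg : 0 ≤ ∑ k, p k ^ 2 := Finset.sum_nonneg fun k _ => sq_nonneg _
  refine .of_dotProduct_mulVec_nonneg (Matrix.IsHermitian.ext fun i j => ?_) fun v => ?_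
  · simp [Matrix.one_apply, eq_comm, mul_comm]
  · have hq : v ⬝ᵥ (Matrix.of fun i j => p i * p j / (1 + ∑ k, p k ^ 2)).mulVec v
        = (∑ i, v i * p i) ^ 2 / (1 + ∑ k, p k ^ 2) := by
      rw [sq, Finset.sum_mul_sum, Finset.sum_div]
      simp only [dotProduct, Matrix.mulVec, Matrix.of_apply, Finset.mul_sum, Finset.sum_div]
      exact Finset.sum_congr rfl fun i _ => Finset.sum_congr rfl fun j _ => by ring
    have hvv : v ⬝ᵥ v = ∑ i, v i ^ 2 := by simp [dotProduct, sq]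
    rw [star_trivial, Matrix.sub_mulVec, Matrix.one_mulVec, dotProduct_sub, hq, hvv, sub_nonneg,
      div_le_iff₀ (by positivity)]
    have hv : 0 ≤ ∑ k, v k ^ 2 := Finset.sum_nonneg fun k _ => sq_nonneg _
    linarith [Finset.sum_mul_sq_le_sq_mul_sq Finset.univ v p]

theorem Matrix.one_sub_of_div_mul_one_add_of {n : ℕ} (p : Fin n → ℝ) :
    ((1 : Matrix (Fin n) (Fin n) ℝ) - Matrix.of fun i j => p i * p j / (1 + ∑ k, p k ^ 2)) *
      (1 + Matrix.of fun i j => p i * p j) = 1 := by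
  have hg : 0 < 1 + ∑ k, p k ^ 2 := by positivity
  have hmul : (Matrix.of fun i j => p i * p j / (1 + ∑ k, p k ^ 2)) *
      (Matrix.of fun i j => p i * p j) =
      ((∑ k, p k ^ 2) / (1 + ∑ k, p k ^ 2)) • Matrix.of fun i j => p i * p j := by
    ext i j
    simp only [Matrix.mul_apply, Matrix.of_apply, Matrix.smul_apply, smul_eq_mul, Finset.sum_div,
      Finset.sum_mul]
    exact Finset.sum_congr rfl fun k _ => by ring
  rw [sub_mul, one_mul, mul_add, mul_one, hmul]
  ext i j
  simp only [Matrix.sub_apply, Matrix.add_apply, Matrix.smul_apply, Matrix.of_apply, smul_eq_mul]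
  field_simp
  ring

/-- A graph with nonnegative mean curvature has, over every ball of radius `r`, a point where
`|A|² ≤ (n + n²) / r²`. -/
theorem exists_trace_shapeOp_sq_le {n : ℕ} (hn : 0 < n) {f : EuclideanSpace ℝ (Fin n) → ℝ}
    (hf : ContDiff ℝ 2 f) (hH : ∀ x, 0 ≤ meanCurv n f x) {r : ℝ} (hr : 0 < r) :
    ∃ x, (shapeOp n f x * shapeOp n f x).trace ≤ (n + n ^ 2) / r ^ 2 := by
  obtain ⟨x, hx, hmin⟩ := exists_isLocalMin_neg_sqrt_sub (hf.differentiable (by norm_num)) hr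
  refine ⟨x, ?_⟩
  have hcomp := fderiv_eq_and_fderiv_fderiv_le_of_isLocalMin hf hx hmin
  have hpos : 0 < r ^ 2 - ‖x‖ ^ 2 := by nlinarith [norm_nonneg x]
  set s := Real.sqrt (r ^ 2 - ‖x‖ ^ 2) with hs
  have hs0 : 0 < s := Real.sqrt_pos.mpr hpos
  have hs2 : s ^ 2 = r ^ 2 - ‖x‖ ^ 2 := Real.sq_sqrt hpos.le
  set p := grad n f x with hp
  have hgrad (i : Fin n) : p i = x i / s := by
    rw [hp, grad, (hcomp _).1]
    simp [EuclideanSpace.inner_single_right]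
  have hg : 1 + gradSq n f x = (r / s) ^ 2 := by
    have : gradSq n f x = ‖x‖ ^ 2 / s ^ 2 := by
      simp only [gradSq, ← hp, hgrad, div_pow, EuclideanSpace.real_norm_sq_eq, Finset.sum_div]
    rw [this, div_pow]
    field_simp
    linarith
  set P : Matrix (Fin n) (Fin n) ℝ :=
    1 - Matrix.of fun i j => p i * p j / (1 + ∑ k, p k ^ 2) with hPdef
  have hP : P.PosSemidef := Matrix.posSemidef_one_sub_of_div p
  set K : Matrix (Fin n) (Fin n) ℝ :=
    (s / r) • (s⁻¹ • (1 + Matrix.of fun i j => p i * p j) - hess n f x) with hKdef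
  have hK : K.PosSemidef := by
    refine Matrix.PosSemidef.smul ?_ (by positivity)
    refine .of_dotProduct_mulVec_nonneg (Matrix.IsHermitian.ext fun i j => ?_) fun v => ?_
    · have := (hess_isHermitian hf x).apply i j
      simp only [star_trivial] at this
      simp [Matrix.one_apply, eq_comm, mul_comm, this]
    · have hle := (hcomp (WithLp.toLp 2 v)).2
      rw [fderiv_fderiv_toLp_eq_dotProduct_hess hf, fderiv_toLp_eq_dotProduct_grad, ← hp,
        EuclideanSpace.real_norm_sq_eq] at hle
      have hq : v ⬝ᵥ (Matrix.of fun i j => p i * p j).mulVec v = (v ⬝ᵥ p) ^ 2 := by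
        simp only [dotProduct, Matrix.mulVec, Matrix.of_apply, Finset.mul_sum]
        rw [sq, Finset.sum_mul_sum]
        exact Finset.sum_congr rfl fun i _ => Finset.sum_congr rfl fun j _ => by ring
      have hvv : v ⬝ᵥ v = ∑ i, v i ^ 2 := by simp [dotProduct, sq]
      rw [star_trivial, Matrix.sub_mulVec, Matrix.smul_mulVec, Matrix.add_mulVec,
        Matrix.one_mulVec, dotProduct_sub, dotProduct_smul, dotProduct_add, hq, hvv, smul_eq_mul,
        sub_nonneg, inv_mul_eq_div]
      exact hle
  have hW : shapeOp n f x = r⁻¹ • 1 - P * K := by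
    have hW' : shapeOp n f x = (s / r) • (P * hess n f x) := by
      have hsqrt : (Real.sqrt (1 + gradSq n f x))⁻¹ = s / r := by
        rw [hg, Real.sqrt_sq (by positivity), inv_div]
      rw [shapeOp, hsqrt]
      rfl
    rw [hW', hKdef, Matrix.mul_smul, Matrix.mul_sub, Matrix.mul_smul, hPdef,
      Matrix.one_sub_of_div_mul_one_add_of, smul_sub, smul_smul]
    rw [show s / r * s⁻¹ = r⁻¹ by field_simp]
    abel
  obtain ⟨hT0, hT2⟩ := hP.trace_mul_nonneg_and_trace_mul_sq_le hK
  have htr : 0 ≤ (shapeOp n f x).trace := by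
    have h := hH x
    rw [meanCurv] at h
    simpa using (le_div_iff₀ (by exact_mod_cast hn)).mp h
  have htrW : (shapeOp n f x).trace = r⁻¹ * n - (P * K).trace := by
    simp [hW, Matrix.trace_sub, Matrix.trace_smul]
  have hsq : (shapeOp n f x * shapeOp n f x).trace
      = n * r⁻¹ ^ 2 - 2 * r⁻¹ * (P * K).trace + (P * K * (P * K)).trace := by
    simp only [hW, sub_mul, mul_sub, Matrix.smul_mul, Matrix.mul_smul, one_mul, mul_one,
      Matrix.trace_sub, Matrix.trace_smul, Matrix.trace_one, Fintype.card_fin, smul_eq_mul]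
    ring
  have hrinv : 0 < r⁻¹ := inv_pos.mpr hr
  have hle : (P * K).trace ^ 2 ≤ (r⁻¹ * n) ^ 2 := pow_le_pow_left₀ hT0 (by linarith) 2
  have hnn := mul_nonneg hrinv.le hT0
  calc (shapeOp n f x * shapeOp n f x).trace ≤ n * r⁻¹ ^ 2 + (r⁻¹ * n) ^ 2 := by linarith
    _ = (n + n ^ 2) / r ^ 2 := by field_simp

theorem shapeOp_neg {n : ℕ} (f : EuclideanSpace ℝ (Fin n) → ℝ) (x : EuclideanSpace ℝ (Fin n)) :
    shapeOp n (-f) x = -shapeOp n f x := by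
  have hgrad : grad n (-f) x = -grad n f x := by
    ext i
    simp [grad, fderiv_neg]
  have hhess : hess n (-f) x = -hess n f x := by
    ext i j
    simp only [hess, Matrix.of_apply, Matrix.neg_apply, fderiv_neg, _root_.neg_apply]
    rw [fderiv_fun_neg, _root_.neg_apply]
  have hsq : gradSq n (-f) x = gradSq n f x := by
    simp [gradSq, hgrad]
  simp [shapeOp, hgrad, hhess, hsq]

theorem exists_normA_lt_of_meanCurv_nonneg {n : ℕ} (hn : 0 < n)
    {f : EuclideanSpace ℝ (Fin n) → ℝ} (hf : ContDiff ℝ 2 f) (hH : ∀ x, 0 ≤ meanCurv n f x)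
    {ε : ℝ} (hε : 0 < ε) : ∃ x, normA n f x < ε := by
  obtain ⟨x, hx⟩ := exists_trace_shapeOp_sq_le hn hf hH (r := (n + 1) / ε) (by positivity)
  refine ⟨x, (Real.sqrt_lt' hε).mpr (hx.trans_lt ?_)⟩
  rw [div_lt_iff₀ (by positivity), div_pow, mul_div_cancel₀ _ (by positivity)]
  have : (0 : ℝ) < n := by exact_mod_cast hn
  nlinarith

/-- **Corollary 3.** If the mean curvature of an entire graph in `ℝ^{n+1}` does not
change sign, then `inf |A| = 0`: for every `ε > 0` there is a point where `|A| < ε`. -/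
theorem inf_normA_entire_graph_eq_zero_of_meanCurv_sign
    (n : ℕ) (hn : 2 ≤ n)
    (f : EuclideanSpace ℝ (Fin n) → ℝ) (hf : ContDiff ℝ 2 f)
    (hH : (∀ x : EuclideanSpace ℝ (Fin n), 0 ≤ meanCurv n f x) ∨
          (∀ x : EuclideanSpace ℝ (Fin n), meanCurv n f x ≤ 0)) :
    ∀ ε > 0, ∃ x : EuclideanSpace ℝ (Fin n), normA n f x < ε := by
  have hn0 : 0 < n := by omega
  intro ε hε
  rcases hH with hH | hH
  · exact exists_normA_lt_of_meanCurv_nonneg hn0 hf hH hε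
  · obtain ⟨x, hx⟩ := exists_normA_lt_of_meanCurv_nonneg (f := -f) hn0 hf.neg (fun x => by
      have h := hH x
      simp only [meanCurv, shapeOp_neg, Matrix.trace_neg, neg_div] at h ⊢
      linarith) hε
    exact ⟨x, by simpa [normA, shapeOp_neg] using hx⟩
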